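/- Perfect hiding of the Pedersen commitment to the verifier's challenge (Appendix B): Let q be a prime, let g : G satisfy g^q = 1, let τ : ZMod q, and set the commitment key k = g^(τ.val). Then for any two challenges e, e' : ZMod q, the distribution of the commitment c = g^(r.val) * k^(e.val) with r uniform in ZMod q is the same as the distribution of g^(r.val) * k^(e'.val) with r uniform in ZMod q. Formally: PMF.map (fun r : ZMod q => g^(r.val) * k^(e.val)) (PMF.uniformOfFintype (ZMod q)) = PMF.map (fun r : ZMod q => g^(r.val) * k^(e'.val)) (PMF.uniformOfFintype (ZMod q)). -/

import Mathlib

/-- The uniform distribution on a finite type is invariant under permutations. -/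
theorem PMF.map_equiv_uniformOfFintype {α : Type*} [Fintype α] [Nonempty α] (σ : α ≃ α) :
    (PMF.uniformOfFintype α).map σ = PMF.uniformOfFintype α := by
  classical
  ext b
  rw [PMF.map_apply, tsum_eq_single (σ.symm b)]
  · simp
  · intro a ha
    rw [if_neg]
    rintro rfl
    simp at ha

/-- Powers of an element killed by `q` depend only on the exponent modulo `q`. -/
theorem pow_mul_pow_pow_zmod_val {M : Type*} [Monoid M] {q : ℕ} [NeZero q] {g : M}
    (hg : g ^ q = 1) (r τ e : ZMod q) :
    g ^ r.val * (g ^ τ.val) ^ e.val = g ^ (r + τ * e).val := by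
  rw [← pow_mul, ← pow_add]
  refine pow_eq_pow_of_modEq ?_ hg
  rw [← ZMod.natCast_eq_natCast_iff]
  simp

/-- Multiplying a uniformly random power of `g` by a power of the key does not change its
distribution. -/
theorem map_pow_mul_key_pow_uniform {M : Type*} [Monoid M] {q : ℕ} [NeZero q] {g : M}
    (hg : g ^ q = 1) (τ e : ZMod q) :
    (PMF.uniformOfFintype (ZMod q)).map (fun r => g ^ r.val * (g ^ τ.val) ^ e.val) =
      (PMF.uniformOfFintype (ZMod q)).map (fun r => g ^ r.val) := by
  simp_rw [pow_mul_pow_pow_zmod_val hg]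
  conv_rhs => rw [← PMF.map_equiv_uniformOfFintype (Equiv.addRight (τ * e)), PMF.map_comp]
  rfl


/-- Perfect hiding of the Pedersen commitment to the verifier's challenge
(Appendix B): the distribution of the commitment is independent of the
committed challenge. -/
theorem pedersen_commitment_perfect_hiding
    {G : Type*} [CommGroup G] (q : ℕ) (hq : q.Prime) [Fact q.Prime]
    (g : G) (hg : g ^ q = 1) (τ : ZMod q) (k : G) (hk : k = g ^ (τ.val))
    (e e' : ZMod q) :
    PMF.map (fun r : ZMod q => g ^ (r.val) * k ^ (e.val))
      (PMF.uniformOfFintype (ZMod q)) =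
    PMF.map (fun r : ZMod q => g ^ (r.val) * k ^ (e'.val))
      (PMF.uniformOfFintype (ZMod q)) := by
  subst hk
  rw [map_pow_mul_key_pow_uniform hg, map_pow_mul_key_pow_uniform hg]
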